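/- Let n, k, d be positive integers with n ≥ k+1, and let D₀ be the digraph defined in the context. Let V* ⊆ V(D₀) with |V*| ≥ 2 be such that |A[V*]|/(|V*|−1) = γ(D₀), i.e. |A[V*]|·(|X|−1) ≥ |A[X]|·(|V*|−1) for every X ⊆ V(D₀) with |X| ≥ 2, and suppose V* is maximal under inclusion among sets with this property. If V* ≠ V(D₀), then (d+1)·|A[V*]| ≤ d(k+1)·(|V*|−1). -/

import Mathlib

/-- Tail map of the digraph `D₀`: the arc `(i, j, t)` has tail `u_{i+j}`. -/
def tail0 (n k d : ℕ) : ZMod n × Fin (k + 1) × Fin d → ZMod n ⊕ ZMod n × Fin d :=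
  fun a => Sum.inl (a.1 + (a.2.1.val : ZMod n))

/-- Head map of the digraph `D₀`: the arc `(i, j, t)` has head `(i, t) ∈ W_i`. -/
def head0 (n k d : ℕ) : ZMod n × Fin (k + 1) × Fin d → ZMod n ⊕ ZMod n × Fin d :=
  fun a => Sum.inr (a.1, a.2.2)

/-- The arcs of `D₀` with both ends in `X`. -/
def arcs0 (n k d : ℕ) (X : Set (ZMod n ⊕ ZMod n × Fin d)) :
    Set (ZMod n × Fin (k + 1) × Fin d) :=
  {a : ZMod n × Fin (k + 1) × Fin d | tail0 n k d a ∈ X ∧ head0 n k d a ∈ X}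

/-- Rotation by `s` combined with the permutation `σ` of every `W_i`, acting on the vertices. -/
def vertexPerm (n d : ℕ) (s : ZMod n) (σ : Equiv.Perm (Fin d)) :
    Equiv.Perm (ZMod n ⊕ ZMod n × Fin d) :=
  Equiv.sumCongr (Equiv.addRight s) (Equiv.prodCongr (Equiv.addRight s) σ)

/-- Rotation by `s` combined with the permutation `σ` of every `W_i`, acting on the arcs. -/
def arcPerm (n k d : ℕ) (s : ZMod n) (σ : Equiv.Perm (Fin d)) :
    Equiv.Perm (ZMod n × Fin (k + 1) × Fin d) :=
  Equiv.prodCongr (Equiv.addRight s) (Equiv.prodCongr (Equiv.refl _) σ)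

@[simp] lemma vertexPerm_inl (n d : ℕ) (s : ZMod n) (σ : Equiv.Perm (Fin d)) (x : ZMod n) :
    vertexPerm n d s σ (Sum.inl x) = Sum.inl (x + s) := rfl

@[simp] lemma vertexPerm_inr (n d : ℕ) (s : ZMod n) (σ : Equiv.Perm (Fin d)) (y : ZMod n)
    (t : Fin d) : vertexPerm n d s σ (Sum.inr (y, t)) = Sum.inr (y + s, σ t) := rfl

lemma tail0_arcPerm (n k d : ℕ) (s : ZMod n) (σ : Equiv.Perm (Fin d))
    (a : ZMod n × Fin (k + 1) × Fin d) :
    tail0 n k d (arcPerm n k d s σ a) = vertexPerm n d s σ (tail0 n k d a) := by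
  simp [tail0, arcPerm, add_right_comm]

lemma head0_arcPerm (n k d : ℕ) (s : ZMod n) (σ : Equiv.Perm (Fin d))
    (a : ZMod n × Fin (k + 1) × Fin d) :
    head0 n k d (arcPerm n k d s σ a) = vertexPerm n d s σ (head0 n k d a) := by
  simp [head0, arcPerm]

lemma ncard_arcs0_image_vertexPerm (n k d : ℕ) (s : ZMod n) (σ : Equiv.Perm (Fin d))
    (X : Set (ZMod n ⊕ ZMod n × Fin d)) :
    (arcs0 n k d (vertexPerm n d s σ '' X)).ncard = (arcs0 n k d X).ncard := by
  rw [← Set.ncard_image_of_injective (arcs0 n k d X) (arcPerm n k d s σ).injective]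
  congr 1
  ext a
  obtain ⟨b, rfl⟩ := (arcPerm n k d s σ).surjective a
  rw [(arcPerm n k d s σ).injective.mem_set_image]
  simp only [arcs0, Set.mem_ofPred_eq, tail0_arcPerm, head0_arcPerm,
    (vertexPerm n d s σ).injective.mem_set_image]

lemma ncard_arcs0_add_le (n k d : ℕ) [NeZero n] (X Y : Set (ZMod n ⊕ ZMod n × Fin d)) :
    (arcs0 n k d X).ncard + (arcs0 n k d Y).ncard
      ≤ (arcs0 n k d (X ∪ Y)).ncard + (arcs0 n k d (X ∩ Y)).ncard := by
  rw [← Set.ncard_union_add_ncard_inter]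
  refine add_le_add (Set.ncard_le_ncard ?_) (Set.ncard_le_ncard ?_)
  · rintro a (⟨h, h'⟩ | ⟨h, h'⟩)
    · exact ⟨Or.inl h, Or.inl h'⟩
    · exact ⟨Or.inr h, Or.inr h'⟩
  · rintro a ⟨⟨h, h'⟩, ⟨h₂, h₂'⟩⟩
    exact ⟨⟨h, h₂⟩, ⟨h', h₂'⟩⟩

lemma ncard_arcs0_of_ncard_eq_one (n k d : ℕ) (X : Set (ZMod n ⊕ ZMod n × Fin d))
    (hX : X.ncard = 1) : (arcs0 n k d X).ncard = 0 := by
  obtain ⟨v, rfl⟩ := Set.ncard_eq_one.mp hX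
  suffices h : arcs0 n k d {v} = ∅ by simp [h]
  ext a
  simp only [arcs0, Set.mem_ofPred_eq, Set.mem_singleton_iff, Set.mem_empty_iff_false, iff_false]
  rintro ⟨h, h'⟩
  exact Sum.inl_ne_inr (h.trans h'.symm)

/-- Uncrossing: a maximal densest set is preserved by every automorphism that maps it to a set
meeting it. -/
lemma image_vertexPerm_eq_of_inter_nonempty (n k d : ℕ) [NeZero n]
    (Vs : Set (ZMod n ⊕ ZMod n × Fin d)) (h2 : 2 ≤ Vs.ncard)
    (hwit : ∀ X : Set (ZMod n ⊕ ZMod n × Fin d), 2 ≤ X.ncard →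
      (arcs0 n k d X).ncard * (Vs.ncard - 1) ≤ (arcs0 n k d Vs).ncard * (X.ncard - 1))
    (hmax : ∀ S : Set (ZMod n ⊕ ZMod n × Fin d), Vs ⊆ S → 2 ≤ S.ncard →
      (∀ X : Set (ZMod n ⊕ ZMod n × Fin d), 2 ≤ X.ncard →
        (arcs0 n k d X).ncard * (S.ncard - 1) ≤ (arcs0 n k d S).ncard * (X.ncard - 1)) →
      S = Vs)
    (s : ZMod n) (σ : Equiv.Perm (Fin d))
    (hne : (Vs ∩ vertexPerm n d s σ '' Vs).Nonempty) :
    vertexPerm n d s σ '' Vs = Vs := by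
  set Y := vertexPerm n d s σ '' Vs
  have hYcard : Y.ncard = Vs.ncard := Set.ncard_image_of_injective _ (vertexPerm n d s σ).injective
  have hYarcs : (arcs0 n k d Y).ncard = (arcs0 n k d Vs).ncard :=
    ncard_arcs0_image_vertexPerm n k d s σ Vs
  have hcard := Set.ncard_union_add_ncard_inter Vs Y
  have hsub := ncard_arcs0_add_le n k d Vs Y
  have hpos : 0 < (Vs ∩ Y).ncard := (Set.ncard_pos).mpr hne
  have hge : Vs.ncard ≤ (Vs ∪ Y).ncard := Set.ncard_le_ncard Set.subset_union_left
  have hinter : (arcs0 n k d (Vs ∩ Y)).ncard * (Vs.ncard - 1)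
      ≤ (arcs0 n k d Vs).ncard * ((Vs ∩ Y).ncard - 1) := by
    rcases Nat.lt_or_ge (Vs ∩ Y).ncard 2 with h | h
    · simp [ncard_arcs0_of_ncard_eq_one n k d (Vs ∩ Y) (by omega)]
    · exact hwit _ h
  have hunion : (arcs0 n k d Vs).ncard * ((Vs ∪ Y).ncard - 1)
      ≤ (arcs0 n k d (Vs ∪ Y)).ncard * (Vs.ncard - 1) := by
    obtain ⟨v, hv⟩ : ∃ v, Vs.ncard = v + 1 := ⟨Vs.ncard - 1, by omega⟩
    obtain ⟨p, hp⟩ : ∃ p, (Vs ∩ Y).ncard = p + 1 := ⟨(Vs ∩ Y).ncard - 1, by omega⟩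
    obtain ⟨q, hq⟩ : ∃ q, (Vs ∪ Y).ncard = q + 1 := ⟨(Vs ∪ Y).ncard - 1, by omega⟩
    rw [hYarcs] at hsub
    rw [hYcard] at hcard
    rw [hv, hp] at hinter
    rw [hv, hq]
    have hqp : q + p = v + v := by omega
    simp only [Nat.add_sub_cancel] at hinter ⊢
    have := Nat.mul_le_mul_right v hsub
    have : (arcs0 n k d Vs).ncard * (q + p) = (arcs0 n k d Vs).ncard * (v + v) := by rw [hqp]
    nlinarith
  have heq : Vs ∪ Y = Vs := by
    refine hmax _ Set.subset_union_left (h2.trans hge) fun Z hZ => ?_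
    refine Nat.le_of_mul_le_mul_right (c := Vs.ncard - 1) ?_ (by omega)
    calc _ = (arcs0 n k d Z).ncard * (Vs.ncard - 1) * ((Vs ∪ Y).ncard - 1) := by ring
      _ ≤ (arcs0 n k d Vs).ncard * (Z.ncard - 1) * ((Vs ∪ Y).ncard - 1) :=
        Nat.mul_le_mul_right _ (hwit Z hZ)
      _ = (arcs0 n k d Vs).ncard * ((Vs ∪ Y).ncard - 1) * (Z.ncard - 1) := by ring
      _ ≤ (arcs0 n k d (Vs ∪ Y)).ncard * (Vs.ncard - 1) * (Z.ncard - 1) :=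
        Nat.mul_le_mul_right _ hunion
      _ = _ := by ring
  exact Set.eq_of_subset_of_ncard_le (Set.union_eq_left.mp heq) hYcard.ge

/-- The rotations that preserve `X`. -/
def rotationStabilizer (n d : ℕ) (X : Set (ZMod n ⊕ ZMod n × Fin d)) : AddSubgroup (ZMod n) where
  carrier := {s | ∀ v, vertexPerm n d s 1 v ∈ X ↔ v ∈ X}
  zero_mem' := by rintro (x | ⟨y, t⟩) <;> simp
  add_mem' := by
    intro a b ha hb v
    rw [← ha v, ← hb (vertexPerm n d a 1 v)]
    rcases v with x | ⟨y, t⟩ <;> simp [add_assoc]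
  neg_mem' := by
    intro a ha v
    rw [← ha]
    rcases v with x | ⟨y, t⟩ <;> simp

/-- A densest set spans an arc. -/
lemma exists_mem_arcs0 (n k d : ℕ) (hd : 0 < d)
    (Vs : Set (ZMod n ⊕ ZMod n × Fin d)) (h2 : 2 ≤ Vs.ncard)
    (hwit : ∀ X : Set (ZMod n ⊕ ZMod n × Fin d), 2 ≤ X.ncard →
      (arcs0 n k d X).ncard * (Vs.ncard - 1) ≤ (arcs0 n k d Vs).ncard * (X.ncard - 1))
    [NeZero n] : (arcs0 n k d Vs).Nonempty := by
  have hpair : ({Sum.inl 0, Sum.inr (0, ⟨0, hd⟩)} : Set (ZMod n ⊕ ZMod n × Fin d)).ncard = 2 :=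
    Set.ncard_pair Sum.inl_ne_inr
  have h := hwit _ hpair.ge
  have hpos : 0 < (arcs0 n k d {Sum.inl 0, Sum.inr (0, ⟨0, hd⟩)}).ncard :=
    (Set.ncard_pos).mpr ⟨(0, 0, ⟨0, hd⟩), by simp [arcs0, tail0, head0]⟩
  rw [hpair] at h
  rw [← Set.ncard_pos]
  have := Nat.mul_pos hpos (show 0 < Vs.ncard - 1 by omega)
  omega

lemma two_mul_ncard_le_of_no_consecutive (k : ℕ) (C : Set (Fin (k + 1)))
    (hC : ∀ i ∈ C, ∀ j ∈ C, i.val + 1 ≠ j.val) : 2 * C.ncard ≤ k + 2 := by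
  have hdisj : Disjoint (Fin.castSucc '' C) (Fin.succ '' C) := by
    rw [Set.disjoint_left]
    rintro _ ⟨i, hi, rfl⟩ ⟨j, hj, h⟩
    exact hC j hj i hi (by simpa using congrArg Fin.val h)
  have h := Set.ncard_le_card (Fin.castSucc '' C ∪ Fin.succ '' C)
  rw [Set.ncard_union_eq hdisj, Set.ncard_image_of_injective _ (Fin.castSucc_injective _),
    Set.ncard_image_of_injective _ (Fin.succ_injective _), Nat.card_eq_fintype_card,
    Fintype.card_fin] at h
  omega

lemma density_bound (k d h c : ℕ) (hk : 0 < k) (hd : 0 < d) (hh : 0 < h) (hch : c ≤ h)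
    (hck : 2 * c ≤ k + 2) :
    (d + 1) * (h * c * d) ≤ d * (k + 1) * (h + h * d - 1) := by
  obtain ⟨m, hm⟩ : ∃ m, h + h * d = m + 1 := ⟨h + h * d - 1, by omega⟩
  rw [hm, Nat.add_sub_cancel]
  obtain ⟨e, he⟩ : ∃ e, k + 1 = c + e := ⟨k + 1 - c, by omega⟩
  have key : k + 1 ≤ (m + 1) * e := by
    rcases Nat.lt_or_ge h 2 with h1 | h1
    · obtain rfl : h = 1 := by omega
      have : 2 ≤ m + 1 := by omega
      nlinarith
    · have : 4 ≤ m + 1 := by nlinarith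
      nlinarith
  have hmain : (m + 1) * c ≤ (k + 1) * m := by
    have : (m + 1) * (k + 1) = (m + 1) * c + (m + 1) * e := by rw [he]; ring
    nlinarith
  calc (d + 1) * (h * c * d) = d * ((h + h * d) * c) := by ring
    _ ≤ d * ((k + 1) * m) := by rw [hm]; exact Nat.mul_le_mul_left d hmain
    _ = _ := by ring

/-- a maximal witness `V*` of the fractional arboricity of `D₀`
which is proper satisfies `(d+1)·|A[V*]| ≤ d(k+1)·(|V*|−1)`. -/
theorem stmt12 (n k d : ℕ) (hk : 0 < k) (hd : 0 < d) (hnk : k + 1 ≤ n)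
    (Vs : Set (ZMod n ⊕ ZMod n × Fin d)) (h2 : 2 ≤ Vs.ncard)
    (hwit : ∀ X : Set (ZMod n ⊕ ZMod n × Fin d), 2 ≤ X.ncard →
      (arcs0 n k d X).ncard * (Vs.ncard - 1) ≤ (arcs0 n k d Vs).ncard * (X.ncard - 1))
    (hmax : ∀ S : Set (ZMod n ⊕ ZMod n × Fin d), Vs ⊆ S → 2 ≤ S.ncard →
      (∀ X : Set (ZMod n ⊕ ZMod n × Fin d), 2 ≤ X.ncard →
        (arcs0 n k d X).ncard * (S.ncard - 1) ≤ (arcs0 n k d S).ncard * (X.ncard - 1)) →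
      S = Vs)
    (hproper : Vs ≠ Set.univ) :
    (d + 1) * (arcs0 n k d Vs).ncard ≤ d * (k + 1) * (Vs.ncard - 1) := by
  have : NeZero n := ⟨by omega⟩
  have huncross := image_vertexPerm_eq_of_inter_nonempty n k d Vs h2 hwit hmax
  have hinv : ∀ s σ v, v ∈ Vs → vertexPerm n d s σ v ∈ Vs →
      ∀ w, vertexPerm n d s σ w ∈ Vs ↔ w ∈ Vs := by
    intro s σ v hv hv' w
    conv_lhs => rw [← huncross s σ ⟨_, hv', v, hv, rfl⟩]
    exact (vertexPerm n d s σ).injective.mem_set_image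
  obtain ⟨⟨y₀, j₀, t₀⟩, htail, hhead⟩ := exists_mem_arcs0 n k d hd Vs h2 hwit
  obtain ⟨x₀, hx₀⟩ : ∃ x, Sum.inl x ∈ Vs := ⟨_, htail⟩
  replace hhead : Sum.inr (y₀, t₀) ∈ Vs := hhead
  set H := rotationStabilizer n d Vs
  have hinl : ∀ s, Sum.inl (x₀ + s) ∈ Vs ↔ s ∈ H := fun s =>
    ⟨fun h => hinv s 1 _ hx₀ h, fun h => (h (Sum.inl x₀)).mpr hx₀⟩
  have hinr₀ : ∀ s, Sum.inr (y₀ + s, t₀) ∈ Vs ↔ s ∈ H := fun s =>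
    ⟨fun h => hinv s 1 _ hhead h, fun h => (h (Sum.inr (y₀, t₀))).mpr hhead⟩
  have hinr : ∀ s t, Sum.inr (y₀ + s, t) ∈ Vs ↔ s ∈ H := by
    intro s t
    rw [← hinr₀]
    simpa using hinv 0 (Equiv.swap t₀ t) (Sum.inl x₀) hx₀ (by simpa using hx₀)
      (Sum.inr (y₀ + s, t₀))
  have hone : (1 : ZMod n) ∉ H := by
    intro h1
    have hall : ∀ s, s ∈ H := fun s => by
      simpa using H.nsmul_mem h1 s.val
    refine hproper (Set.eq_univ_of_forall ?_)
    rintro (x | ⟨y, t⟩)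
    · simpa using (hinl (x - x₀)).mpr (hall _)
    · simpa using (hinr (y - y₀) t).mpr (hall _)
  set C : Set (Fin (k + 1)) := {j | y₀ - x₀ + (j.val : ZMod n) ∈ H} with hC
  have hVs : Vs.ncard = (H : Set (ZMod n)).ncard + (H : Set (ZMod n)).ncard * d := by
    have : Vs = (fun s => Sum.inl (x₀ + s)) '' (H : Set (ZMod n)) ∪
        (fun p : ZMod n × Fin d => Sum.inr (y₀ + p.1, p.2)) ''
          ((H : Set (ZMod n)) ×ˢ Set.univ) := by
      ext v
      rcases v with x | ⟨y, t⟩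
      · have := hinl (x - x₀)
        rw [add_sub_cancel] at this
        simp [this, ← eq_sub_iff_add_eq']
      · have := hinr (y - y₀) t
        rw [add_sub_cancel] at this
        simp [this, ← eq_sub_iff_add_eq']
    conv_lhs => rw [this]
    rw [Set.ncard_union_eq, Set.ncard_image_of_injective, Set.ncard_image_of_injective,
      Set.ncard_prod, Set.ncard_univ, Nat.card_eq_fintype_card, Fintype.card_fin]
    · rintro ⟨a, t⟩ ⟨b, t'⟩ h
      simpa using h
    · intro a b h
      simpa using h
    · rw [Set.disjoint_left]
      rintro _ ⟨a, -, rfl⟩ ⟨b, -, h⟩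
      exact Sum.inr_ne_inl h
  have harcs : (arcs0 n k d Vs).ncard = (H : Set (ZMod n)).ncard * C.ncard * d := by
    have : arcs0 n k d Vs = (fun p : ZMod n × Fin (k + 1) × Fin d => (y₀ + p.1, p.2)) ''
        ((H : Set (ZMod n)) ×ˢ (C ×ˢ Set.univ)) := by
      ext ⟨i, j, t⟩
      obtain ⟨s, rfl⟩ : ∃ s, i = y₀ + s := ⟨i - y₀, by ring⟩
      have hi : Function.Injective
          (fun p : ZMod n × Fin (k + 1) × Fin d => (y₀ + p.1, p.2)) := by
        rintro ⟨a, p⟩ ⟨b, q⟩ h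
        simpa using h
      rw [show (y₀ + s, j, t) = (fun p : ZMod n × Fin (k + 1) × Fin d => (y₀ + p.1, p.2))
        (s, j, t) from rfl, hi.mem_set_image]
      have htl := hinl (s + (y₀ - x₀ + (j.val : ZMod n)))
      rw [show x₀ + (s + (y₀ - x₀ + (j.val : ZMod n))) = y₀ + s + (j.val : ZMod n) by ring] at htl
      simp only [arcs0, tail0, head0, Set.mem_ofPred_eq, Set.mem_prod, SetLike.mem_coe,
        Set.mem_univ, and_true, hinr, htl, hC]
      rw [and_comm]
      exact and_congr_right fun hs => H.add_mem_cancel_left hs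
    rw [this, Set.ncard_image_of_injective, Set.ncard_prod, Set.ncard_prod, Set.ncard_univ,
      Nat.card_eq_fintype_card, Fintype.card_fin, mul_assoc]
    rintro ⟨a, p⟩ ⟨b, q⟩ h
    simpa using h
  have hHpos : 0 < (H : Set (ZMod n)).ncard := (Set.ncard_pos).mpr ⟨0, H.zero_mem⟩
  have hCH : C.ncard ≤ (H : Set (ZMod n)).ncard := by
    refine Set.ncard_le_ncard_of_injOn (fun j => y₀ - x₀ + (j.val : ZMod n)) (fun j hj => hj) ?_
    intro i _ j _ hij
    have h := congrArg ZMod.val (add_left_cancel hij)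
    rw [ZMod.val_natCast_of_lt (i.isLt.trans_le hnk),
      ZMod.val_natCast_of_lt (j.isLt.trans_le hnk)] at h
    exact Fin.ext h
  have hCk : 2 * C.ncard ≤ k + 2 := by
    refine two_mul_ncard_le_of_no_consecutive k C fun i hi j hj hij => hone ?_
    have h := H.sub_mem hj hi
    rw [← hij] at h
    simpa using h
  rw [harcs, hVs]
  exact density_bound k d _ _ hk hd hHpos hCH hCk
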